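/- arXiv:1109.6676 — 4 statements merged into one kernel-verified Lean document; each statement's English description precedes it below -/
import Mathlib

section
/- Let ℓ be an odd prime and n ≥ 1. If M is an n×n matrix over the ℓ-adic integers ℤ_ℓ of finite multiplicative order (i.e. M^k = 1 for some k ≥ 1) such that every entry of M − 1 is divisible by ℓ, then M = 1. -/
theorem exists_one_add_pow_eq_add_cube_mul {R : Type*} [Ring R] (x : R) (n : ℕ) :
    ∃ s : R, (1 + x) ^ n = 1 + n * x + n.choose 2 * x ^ 2 + x ^ 3 * s := by
  have key : ∃ s : Polynomial ℤ, (1 + Polynomial.X) ^ n =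
      1 + (n : Polynomial ℤ) * Polynomial.X + (n.choose 2 : Polynomial ℤ) * Polynomial.X ^ 2 +
        Polynomial.X ^ 3 * s := by
    induction n with
    | zero => exact ⟨0, by simp⟩
    | succ n ih =>
      obtain ⟨s, hs⟩ := ih
      refine ⟨s + Polynomial.X * s + (n.choose 2 : Polynomial ℤ), ?_⟩
      rw [pow_succ, hs, Nat.choose_succ_succ' n 1, Nat.choose_one_right]
      push_cast
      ring
  obtain ⟨s, hs⟩ := key
  exact ⟨Polynomial.aeval x s, by simpa using congrArg (Polynomial.aeval x) hs⟩

theorem natCast_dvd_of_dvd_natCast_mul {R : Type*} [Ring R] {p q : ℕ} (hpq : p.Coprime q) {y : R}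
    (h : (p : R) ∣ q * y) : (p : R) ∣ y := by
  obtain ⟨z, hz⟩ := h
  have bezout : (1 : R) = p * p.gcdA q + q * p.gcdB q := by
    have := Nat.gcd_eq_gcd_ab p q
    rw [hpq.gcd_eq_one] at this
    exact_mod_cast congrArg (Int.cast : ℤ → R) this
  refine ⟨p.gcdA q * y + p.gcdB q * z, ?_⟩
  calc y = (p * p.gcdA q + q * p.gcdB q) * y := by rw [← bezout, one_mul]
    _ = p * (p.gcdA q * y) + p.gcdB q * (q * y) := by
      rw [add_mul, mul_assoc, (Nat.cast_commute q (p.gcdB q : R)).eq, mul_assoc]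
    _ = p * (p.gcdA q * y + p.gcdB q * z) := by
      rw [hz, mul_add, ← mul_assoc (p.gcdB q : R), ← (Nat.cast_commute p (p.gcdB q : R)).eq,
        mul_assoc (p : R) (p.gcdB q : R)]

/-- If `1 + p ^ m * y` with `m ≥ 1` has prime order, then `p` divides `y`. -/
theorem natCast_dvd_of_one_add_pow_prime_eq_one {R : Type*} [Ring R] {p q : ℕ} (hp : p.Prime)
    (hodd : Odd p) (hq : q.Prime) (hreg : IsLeftRegular (p : R)) {m : ℕ} (hm : 1 ≤ m) {y : R}
    (h : (1 + (p : R) ^ m * y) ^ q = 1) : (p : R) ∣ y := by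
  obtain ⟨s, hs⟩ := exists_one_add_pow_eq_add_cube_mul ((p : R) ^ m * y) q
  have hcomm (k : ℕ) (a : R) : Commute ((p : R) ^ k) a := (Nat.cast_commute p a).pow_left k
  obtain ⟨m, rfl⟩ := Nat.exists_eq_add_of_le' hm
  have hzero : (q : R) * ((p : R) ^ (m + 1) * y) + q.choose 2 * ((p : R) ^ (m + 1) * y) ^ 2
      + ((p : R) ^ (m + 1) * y) ^ 3 * s = 0 := by
    rw [h, add_assoc, add_assoc, left_eq_add] at hs
    rwa [add_assoc]
  rw [(hcomm (m + 1) y).mul_pow, (hcomm (m + 1) y).mul_pow, ← pow_mul, ← pow_mul] at hzero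
  have hfactor : (p : R) ^ (m + 1) * (q * y + p * (p ^ m * (q.choose 2 * y ^ 2)
      + p ^ (2 * m + 1) * (y ^ 3 * s))) = 0 := by
    rw [← hzero]
    simp only [mul_add, ← mul_assoc, ← pow_succ, ← pow_add]
    rw [(hcomm (m + 1) (q : R)).eq, ((hcomm ((m + 1) * 2) (q.choose 2 : R))).symm.eq,
      ← add_assoc]
    congr 4 <;> ring_nf
  have hlin := (hreg.pow (m + 1)) (hfactor.trans (mul_zero _).symm)
  rcases eq_or_ne p q with rfl | hne
  · obtain ⟨c, hc⟩ := hp.dvd_choose_self two_ne_zero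
      (lt_of_le_of_ne hp.two_le (by rintro rfl; exact absurd hodd (by decide)))
    rw [← mul_add] at hlin
    have hy := hreg (hlin.trans (mul_zero _).symm)
    rw [eq_neg_of_add_eq_zero_left hy, dvd_neg, hc]
    refine dvd_add ?_ ?_
    · rw [← mul_assoc, (hcomm m _).eq, Nat.cast_mul, mul_assoc, mul_assoc]
      exact dvd_mul_right _ _
    · rw [pow_succ', mul_assoc]
      exact dvd_mul_right _ _
  · refine natCast_dvd_of_dvd_natCast_mul ((Nat.coprime_primes hp hq).2 hne) ?_
    rw [eq_neg_of_add_eq_zero_left hlin, dvd_neg]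
    exact dvd_mul_right _ _

/-- In a `p`-torsion-free, `p`-adically separated ring with `p` an odd prime, the only element of
finite order congruent to `1` modulo `p` is `1`. -/
theorem eq_one_of_pow_eq_one_of_natCast_dvd_sub_one {R : Type*} [Ring R] {p : ℕ} (hp : p.Prime)
    (hodd : Odd p) (hreg : IsLeftRegular (p : R))
    (hsep : ∀ x : R, (∀ m : ℕ, (p : R) ^ m ∣ x) → x = 0) {k : ℕ} (hk : k ≠ 0) {x : R}
    (hx : (p : R) ∣ x - 1) (hpow : x ^ k = 1) : x = 1 := by
  induction k using induction_on_primes with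
  | zero => exact absurd rfl hk
  | one => simpa using hpow
  | prime_mul q a hq ih =>
    refine ih (right_ne_zero_of_mul hk) (sub_eq_zero.1 (hsep _ fun m => ?_))
    have hxa : (p : R) ∣ x ^ a - 1 := hx.trans ⟨_, (mul_geom_sum x a).symm⟩
    suffices ∀ m : ℕ, (p : R) ^ (m + 1) ∣ x ^ a - 1 from (pow_dvd_pow _ m.le_succ).trans (this m)
    intro m
    induction m with
    | zero => simpa using hxa
    | succ m ihm =>
      obtain ⟨y, hy⟩ := ihm
      rw [hy, pow_succ (p : R) (m + 1)]
      refine mul_dvd_mul_left _ (natCast_dvd_of_one_add_pow_prime_eq_one hp hodd hq hreg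
        (Nat.le_add_left 1 m) ?_)
      rw [← hy, add_sub_cancel, ← pow_mul, mul_comm, hpow]

theorem Matrix.natCast_pow_dvd_iff {m R : Type*} [Fintype m] [DecidableEq m] [CommRing R]
    (p k : ℕ) (A : Matrix m m R) : (p : Matrix m m R) ^ k ∣ A ↔ ∀ i j, (p : R) ^ k ∣ A i j := by
  have hmul (B : Matrix m m R) : (p : Matrix m m R) ^ k * B = (p : R) ^ k • B := by
    rw [← Nat.cast_pow, ← Nat.cast_pow, ← nsmul_eq_mul, Nat.cast_smul_eq_nsmul]
  constructor
  · rintro ⟨B, rfl⟩ i j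
    rw [hmul]
    exact dvd_mul_right _ _
  · intro h
    choose B hB using h
    exact ⟨Matrix.of B, by rw [hmul]; ext i j; simpa using hB i j⟩


/-- If `M` is an `n × n` matrix over the `ℓ`-adic integers (`ℓ` an odd prime, `n ≥ 1`)
of finite multiplicative order which is congruent to the identity modulo `ℓ`
(every entry of `M - 1` is divisible by `ℓ`), then `M = 1`. -/
theorem torsion_matrix_congruent_one_eq_one
    (ℓ : ℕ) [Fact ℓ.Prime] (hℓ : Odd ℓ) (n : ℕ) (hn : 1 ≤ n)
    (M : Matrix (Fin n) (Fin n) ℤ_[ℓ])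
    (hfin : ∃ k : ℕ, 1 ≤ k ∧ M ^ k = 1)
    (hdiv : ∀ i j, (ℓ : ℤ_[ℓ]) ∣ (M - 1) i j) :
    M = 1 := by
  obtain ⟨k, hk, hpow⟩ := hfin
  have hp : ℓ.Prime := Fact.out
  refine eq_one_of_pow_eq_one_of_natCast_dvd_sub_one hp hℓ ?_ (fun A hA => ?_)
    (Nat.one_le_iff_ne_zero.1 hk) ?_ hpow
  · intro A B hAB
    simp only [← nsmul_eq_mul] at hAB
    ext i j : 2
    have hij := congrFun (congrFun hAB i) j
    simp only [Matrix.smul_apply, nsmul_eq_mul] at hij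
    exact mul_left_cancel₀ (Nat.cast_ne_zero.2 hp.ne_zero) hij
  · ext i j : 2
    by_contra hne
    exact FiniteMultiplicity.not_iff_forall.2
      (fun m => (Matrix.natCast_pow_dvd_iff ℓ m A).1 (hA m) i j)
      (FiniteMultiplicity.of_prime_left PadicInt.prime_p hne)
  · simpa using (Matrix.natCast_pow_dvd_iff ℓ 1 (M - 1)).2 (by simpa using hdiv)
end

section
/- Let ℓ be an odd prime and n ≥ 1. If M is an n×n matrix over the ℓ-adic integers ℤ_ℓ such that every entry of M − 1 is divisible by ℓ, and (M^k − 1)² = 0 for some integer k ≥ 1, then (M − 1)² = 0. -/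
/-- A matrix over `ℤ_[p]` congruent modulo `p` to a natural number prime to `p` is invertible. -/
theorem isUnit_natCast_add_smul {p : ℕ} [Fact p.Prime] {m : Type*} [Fintype m] [DecidableEq m]
    {c : ℕ} (hc : ¬ p ∣ c) (Z : Matrix m m ℤ_[p]) :
    IsUnit ((c : Matrix m m ℤ_[p]) + (p : ℤ_[p]) • Z) := by
  rw [Matrix.isUnit_iff_isUnit_det]
  apply isUnit_of_map_unit (PadicInt.toZMod (p := p))
  have hmap : (PadicInt.toZMod (p := p)).mapMatrix
      ((c : Matrix m m ℤ_[p]) + (p : ℤ_[p]) • Z) = Matrix.diagonal fun _ => (c : ZMod p) := by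
    rw [map_add, map_natCast, ← Matrix.diagonal_natCast]
    ext i j
    simp
  rw [RingHom.map_det, hmap, Matrix.det_diagonal, Finset.prod_const]
  refine (IsUnit.mk0 _ ?_).pow _
  rwa [Ne, ZMod.natCast_eq_zero_iff]

section PowExpansion

variable {R A : Type*} [CommRing R] [Ring A] [Algebra R A]

theorem exists_one_add_smul_pow_eq (r : R) (N : A) (i : ℕ) :
    ∃ Z : A, (1 + r • N) ^ i = 1 + (i * r) • N + r ^ 2 • Z := by
  induction i with
  | zero => exact ⟨0, by simp⟩
  | succ i ih =>
    obtain ⟨Z, hZ⟩ := ih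
    refine ⟨(i : R) • (N * N) + Z + r • (Z * N), ?_⟩
    rw [pow_succ, hZ]
    simp only [mul_add, add_mul, mul_one, one_mul, smul_mul_assoc, mul_smul_comm, Nat.cast_add,
      Nat.cast_one]
    module

theorem exists_geom_sum_one_add_smul_eq (r : R) (N : A) (k : ℕ) :
    ∃ Z : A, ∑ i ∈ Finset.range k, (1 + r • N) ^ i =
      (k : A) + (((∑ i ∈ Finset.range k, i : ℕ) : R) * r) • N + r ^ 2 • Z := by
  choose Z hZ using exists_one_add_smul_pow_eq r N
  refine ⟨∑ i ∈ Finset.range k, Z i, ?_⟩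
  simp only [hZ, Finset.sum_add_distrib, ← Finset.sum_smul, ← Finset.smul_sum, ← Finset.sum_mul,
    Nat.cast_sum]
  simp

end PowExpansion

/-- For an odd prime `p` and a prime `q`, a matrix congruent to `1` modulo `p` over `ℤ_[p]` has
`1 + M + ⋯ + M ^ (q - 1)` equal to a nonzero scalar times an invertible matrix. -/
theorem exists_geom_sum_eq_smul_isUnit {p : ℕ} [Fact p.Prime] (hp : Odd p)
    {m : Type*} [Fintype m] [DecidableEq m] (N : Matrix m m ℤ_[p]) {q : ℕ} (hq : q.Prime) :
    ∃ (a : ℤ_[p]) (T : Matrix m m ℤ_[p]), a ≠ 0 ∧ IsUnit T ∧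
      ∑ i ∈ Finset.range q, (1 + (p : ℤ_[p]) • N) ^ i = a • T := by
  have hprime : p.Prime := Fact.out
  obtain ⟨Z, hZ⟩ := exists_geom_sum_one_add_smul_eq (p : ℤ_[p]) N q
  by_cases hqp : p = q
  · subst hqp
    obtain ⟨t, ht⟩ := hp
    have hsum : ∑ i ∈ Finset.range p, i = p * t := by
      rw [Finset.sum_range_id, show p - 1 = t * 2 by lia, ← mul_assoc,
        Nat.mul_div_cancel _ two_pos]
    refine ⟨p, _, by exact_mod_cast hprime.ne_zero,
      isUnit_natCast_add_smul hprime.not_dvd_one ((t : ℤ_[p]) • N + Z), ?_⟩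
    have hcast : ((p : ℕ) : Matrix m m ℤ_[p]) = (p : ℤ_[p]) • 1 := by
      rw [Nat.cast_smul_eq_nsmul, nsmul_one]
    rw [hZ, hsum, hcast, Nat.cast_one, Nat.cast_mul]
    module
  · refine ⟨1, _, one_ne_zero, isUnit_natCast_add_smul
      (fun h => hqp ((Nat.prime_dvd_prime_iff_eq hprime hq).1 h))
      (((∑ i ∈ Finset.range q, i : ℕ) : ℤ_[p]) • N + (p : ℤ_[p]) • Z), ?_⟩
    rw [hZ]
    module

/-- If `M` is an `n × n` matrix over the `ℓ`-adic integers (`ℓ` an odd prime, `n ≥ 1`)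
congruent to the identity modulo `ℓ`, and some power `M ^ k` (`k ≥ 1`) is unipotent of
degree 2 (i.e. `(M ^ k - 1) ^ 2 = 0`), then `M` itself is unipotent of degree 2. -/
theorem unipotent_power_matrix_congruent_one
    (ℓ : ℕ) [Fact ℓ.Prime] (hℓ : Odd ℓ) (n : ℕ) (hn : 1 ≤ n)
    (M : Matrix (Fin n) (Fin n) ℤ_[ℓ])
    (hdiv : ∀ i j, (ℓ : ℤ_[ℓ]) ∣ (M - 1) i j)
    (hk : ∃ k : ℕ, 1 ≤ k ∧ (M ^ k - 1) ^ 2 = 0) :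
    (M - 1) ^ 2 = 0 := by
  obtain ⟨k, hk, h⟩ := hk
  choose N hN using hdiv
  obtain ⟨N, rfl⟩ : ∃ N : Matrix (Fin n) (Fin n) ℤ_[ℓ], M = 1 + (ℓ : ℤ_[ℓ]) • N := by
    refine ⟨Matrix.of N, sub_eq_iff_eq_add'.1 ?_⟩
    ext1 i j
    simpa using hN i j
  clear hN
  induction k using induction_on_primes generalizing N with
  | zero => omega
  | one => simpa using h
  | prime_mul q k hq ih =>
    obtain ⟨Z, hZ⟩ := exists_one_add_smul_pow_eq (ℓ : ℤ_[ℓ]) N q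
    have hpow : (1 + (ℓ : ℤ_[ℓ]) • N) ^ q =
        1 + (ℓ : ℤ_[ℓ]) • ((q : ℤ_[ℓ]) • N + (ℓ : ℤ_[ℓ]) • Z) := by
      rw [hZ]
      module
    have hq_sq : ((1 + (ℓ : ℤ_[ℓ]) • N) ^ q - 1) ^ 2 = 0 := by
      rw [hpow]
      refine ih (Nat.pos_of_mul_pos_left hk) _ ?_
      rwa [← hpow, ← pow_mul]
    obtain ⟨a, T, ha, hT, hS⟩ := exists_geom_sum_eq_smul_isUnit hℓ N hq
    have hcomm : Commute (1 + (ℓ : ℤ_[ℓ]) • N - 1)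
        (∑ i ∈ Finset.range q, (1 + (ℓ : ℤ_[ℓ]) • N) ^ i) :=
      (mul_geom_sum _ q).trans (geom_sum_mul _ q).symm
    rw [← mul_geom_sum, hcomm.mul_pow, hS, smul_pow, mul_smul_comm] at hq_sq
    exact (hT.pow 2).mul_left_eq_zero.1 ((smul_eq_zero.1 hq_sq).resolve_left (pow_ne_zero 2 ha))
end

section
/- Let p > 5 be a prime, F a field of characteristic p, and H a subgroup of GL₂(F) containing an element u with u ≠ 1 and (u − 1)² = 0. Then the image of H in PGL₂(F) is not isomorphic to A₄, S₄, or A₅. -/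
open Matrix in
theorem Matrix.GeneralLinearGroup.eq_one_of_mem_center_of_sub_one_sq_eq_zero
    {n R : Type*} [Fintype n] [DecidableEq n] [Nonempty n] [CommRing R] [IsReduced R]
    {u : GL n R} (hu : u ∈ Subgroup.center (GL n R))
    (h : ((u : Matrix n n R) - 1) ^ 2 = 0) : u = 1 := by
  obtain ⟨a, ha⟩ := mem_center_iff_val_mem_range_scalar.mp hu
  change Matrix.scalar n a = (u : Matrix n n R) at ha
  rw [← ha, ← map_one (Matrix.scalar n), ← map_sub, ← map_pow, ← map_zero (Matrix.scalar n),
    Matrix.scalar_inj] at h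
  have ha1 : a = 1 := sub_eq_zero.mp (eq_zero_of_pow_eq_zero h)
  apply Units.ext
  rw [← ha, ha1, map_one, Units.val_one]

open Matrix in
theorem Matrix.GeneralLinearGroup.pow_char_eq_one_of_sub_one_sq_eq_zero
    {n R : Type*} [Fintype n] [DecidableEq n] [Nonempty n] [CommRing R]
    {p : ℕ} [Fact p.Prime] [CharP R p] {u : GL n R}
    (h : ((u : Matrix n n R) - 1) ^ 2 = 0) : u ^ p = 1 := by
  apply Units.ext
  rw [Units.val_pow_eq_pow_val, Units.val_one, ← sub_eq_zero]
  have hsub := sub_pow_char_of_commute p (Commute.one_right (u : Matrix n n R))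
  rw [one_pow] at hsub
  rw [← hsub]
  exact pow_eq_zero_of_le (Fact.out : p.Prime).two_le h

/-- The image in the projective linear group of a subgroup of `GL n R` containing a nontrivial
element `u` with `(u - 1) ^ 2 = 0` has order divisible by the characteristic. -/
theorem Matrix.GeneralLinearGroup.char_dvd_card_map_of_sub_one_sq_eq_zero
    {n R : Type*} [Fintype n] [DecidableEq n] [Nonempty n] [CommRing R] [IsReduced R]
    {p : ℕ} [Fact p.Prime] [CharP R p] {H : Subgroup (GL n R)} {u : GL n R}
    (huH : u ∈ H) (hu : u ≠ 1) (h : ((u : Matrix n n R) - 1) ^ 2 = 0) :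
    p ∣ Nat.card (H.map (QuotientGroup.mk' (Subgroup.center (GL n R)))) := by
  have hord : orderOf (QuotientGroup.mk' (Subgroup.center (GL n R)) u) = p := by
    apply orderOf_eq_prime
    · rw [← map_pow, pow_char_eq_one_of_sub_one_sq_eq_zero h, map_one]
    · intro h1
      exact hu (eq_one_of_mem_center_of_sub_one_sq_eq_zero
        ((QuotientGroup.eq_one_iff u).mp h1) h)
  have hdvd := Subgroup.orderOf_dvd_natCard _
    (Subgroup.mem_map_of_mem (QuotientGroup.mk' (Subgroup.center (GL n R))) huH)
  rwa [hord] at hdvd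


/-- Let `p > 5` be a prime, `F` a field of characteristic `p`, and `H ≤ GL₂(F)` a subgroup
containing an element `u ≠ 1` with `(u - 1)² = 0`. Then the image of `H` in `PGL₂(F)` is
not isomorphic to `A₄`, `S₄` or `A₅`. -/
theorem image_not_exceptional_of_unipotent (p : ℕ) (hp : p.Prime) (hp5 : 5 < p)
    (F : Type) [Field F] (hchar : CharP F p)
    (H : Subgroup (GL (Fin 2) F)) (u : GL (Fin 2) F) (huH : u ∈ H) (hu : u ≠ 1)
    (h2 : ((u : Matrix (Fin 2) (Fin 2) F) - 1) ^ 2 = 0) :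
    ¬ Nonempty ((H.map (QuotientGroup.mk' (Subgroup.center (GL (Fin 2) F))))
        ≃* alternatingGroup (Fin 4)) ∧
    ¬ Nonempty ((H.map (QuotientGroup.mk' (Subgroup.center (GL (Fin 2) F))))
        ≃* Equiv.Perm (Fin 4)) ∧
    ¬ Nonempty ((H.map (QuotientGroup.mk' (Subgroup.center (GL (Fin 2) F))))
        ≃* alternatingGroup (Fin 5)) := by
  have : Fact p.Prime := ⟨hp⟩
  have hdvd := Matrix.GeneralLinearGroup.char_dvd_card_map_of_sub_one_sq_eq_zero (p := p) huH hu h2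
  have key (G : Type) [Group G] (hG : Nat.card G ∣ Nat.factorial 5) :
      ¬ Nonempty ((H.map (QuotientGroup.mk' (Subgroup.center (GL (Fin 2) F)))) ≃* G) := by
    rintro ⟨e⟩
    rw [Nat.card_congr e.toEquiv] at hdvd
    exact hp5.not_ge (hp.dvd_factorial.mp (hdvd.trans hG))
  refine ⟨key _ ?_, key _ ?_, key _ ?_⟩
  · rw [nat_card_alternatingGroup, Nat.card_fin]
    decide
  · rw [Nat.card_perm, Nat.card_fin]
    decide
  · rw [nat_card_alternatingGroup, Nat.card_fin]
    decide
end

section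
/- Let p > 5 be a prime, let n ∈ {2, 3, 4, 5} divide p + 1, and let m be an integer with 1 ≤ m < n and gcd(m, n) = 1. Set j := m(p+1)/n − 1boxer. If j + 1 ≠ (p+1)/2, then gcd(j, p − 1) ≤ 3. -/
/-- Let `p > 5` be a prime, let `n ∈ {2, 3, 4, 5}` divide `p + 1`, and let `m` satisfy
`1 ≤ m < n` and `gcd(m, n) = 1`. Set `j := m * (p + 1) / n - 1`. If `j + 1 ≠ (p + 1) / 2`,
then `gcd(j, p - 1) ≤ 3`. -/
theorem gcd_le_three_of_nebentypus (p : ℕ) (hp : p.Prime) (hp5 : 5 < p)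
    (n : ℕ) (hn : n ∈ ({2, 3, 4, 5} : Set ℕ)) (hdvd : n ∣ p + 1)
    (m : ℕ) (hm1 : 1 ≤ m) (hmn : m < n) (hgcd : Nat.gcd m n = 1)
    (j : ℕ) (hj : j = m * (p + 1) / n - 1)
    (hne : j + 1 ≠ (p + 1) / 2) :
    Nat.gcd j (p - 1) ≤ 3 := by
  obtain ⟨k, hk⟩ := hdvd
  have hn2 : 2 ≤ n ∧ n ≤ 5 := by
    simp only [Set.mem_insert_iff, Set.mem_singleton_iff] at hn
    omega
  have hk0 : 0 < k := Nat.pos_of_ne_zero (by rintro rfl; omega)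
  have hmk : 0 < m * k := Nat.mul_pos hm1 hk0
  have hj' : j + 1 = m * k := by
    rw [hj, hk, Nat.mul_left_comm, Nat.mul_div_cancel_left _ (by omega)]
    omega
  have hne' : (2 * m - n : ℤ) ≠ 0 := by
    intro h
    obtain rfl : n = 2 * m := by omega
    obtain rfl : m = 1 := by simpa using hgcd
    omega
  have hd : ((Nat.gcd j (p - 1) : ℕ) : ℤ) ∣ 2 * m - n := by
    have h1 : ((Nat.gcd j (p - 1) : ℕ) : ℤ) ∣ (j : ℤ) :=
      Int.natCast_dvd_natCast.mpr (Nat.gcd_dvd_left _ _)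
    have h2 : ((Nat.gcd j (p - 1) : ℕ) : ℤ) ∣ ((p - 1 : ℕ) : ℤ) :=
      Int.natCast_dvd_natCast.mpr (Nat.gcd_dvd_right _ _)
    have hjz : (j : ℤ) = m * k - 1 := by
      rw [← Nat.cast_mul, ← hj']
      push_cast
      ring
    have hpz : ((p - 1 : ℕ) : ℤ) = n * k - 2 := by
      rw [← Nat.cast_mul, ← hk]
      omega
    have h : (2 * m - n : ℤ) = n * j - m * ((p - 1 : ℕ) : ℤ) := by
      rw [hjz, hpz]
      ring
    rw [h]
    exact dvd_sub (h1.mul_left _) (h2.mul_left _)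
  have hle := Int.le_of_dvd (abs_pos.mpr hne') ((dvd_abs _ _).mpr hd)
  have habs : |(2 * m - n : ℤ)| ≤ 3 := abs_le.mpr ⟨by omega, by omega⟩
  exact_mod_cast hle.trans habs
end
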